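/- In the Marsh–Rietsch setup over ℂ with all parameters t_r ≠ 0: the matrix gᵀ·ẇ admits a UDL factorization, and, setting y⃗ := [gᵀẇ]_L^+, for every i ∈ {1,…,n} one has Δ^{v⁻¹({1,…,i})}_{w⁻¹({1,…,i})}(y⃗) · Δ^{{1,…,i}}_{w⁻¹({1,…,i})}(g) = 1, where v⁻¹({1,…,i}) = {v⁻¹(1),…,v⁻¹(i)} and w⁻¹({1,…,i}) = {w⁻¹(1),…,w⁻¹(i)}. -/

import Mathlib

open Matrix Finset
set_option linter.all false

namespace Paper

open scoped Classical

noncomputable section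

variable {K : Type*} [Field K] {n m : ℕ}

/-- `N`: upper unitriangular matrices. -/
def IsN (g : Matrix (Fin n) (Fin n) K) : Prop :=
  (∀ i, g i i = 1) ∧ ∀ i j : Fin n, j < i → g i j = 0

/-- `N₋`: lower unitriangular matrices. -/
def IsNm (g : Matrix (Fin n) (Fin n) K) : Prop :=
  (∀ i, g i i = 1) ∧ ∀ i j : Fin n, i < j → g i j = 0

/-- `B`: upper triangular matrices of determinant 1. -/
def IsB (g : Matrix (Fin n) (Fin n) K) : Prop :=
  g.det = 1 ∧ ∀ i j : Fin n, j < i → g i j = 0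

/-- `B₋`: lower triangular matrices of determinant 1. -/
def IsBm (g : Matrix (Fin n) (Fin n) K) : Prop :=
  g.det = 1 ∧ ∀ i j : Fin n, i < j → g i j = 0

/-- `H`: diagonal matrices of determinant 1. -/
def IsH (g : Matrix (Fin n) (Fin n) K) : Prop :=
  g.det = 1 ∧ ∀ i j : Fin n, i ≠ j → g i j = 0

/-- UDL factorization: `g = yp * y0 * ym` with `yp ∈ N`, `y0 ∈ H`, `ym ∈ N₋`. -/
def UDL (g yp y0 ym : Matrix (Fin n) (Fin n) K) : Prop :=
  IsN yp ∧ IsH y0 ∧ IsNm ym ∧ g = yp * y0 * ym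

/-- LDU factorization: `g = zm * z0 * zp` with `zm ∈ N₋`, `z0 ∈ H`, `zp ∈ N`. -/
def LDU (g zm z0 zp : Matrix (Fin n) (Fin n) K) : Prop :=
  IsNm zm ∧ IsH z0 ∧ IsN zp ∧ g = zm * z0 * zp

/-- The signed permutation matrix `v̇`. -/
def pdot (v : Equiv.Perm (Fin n)) : Matrix (Fin n) (Fin n) K :=
  Matrix.of fun a b : Fin n =>
    if a = v b then
      (-1 : K) ^ (univ.filter fun k : Fin n => b < k ∧ v k < v b).card
    else 0

/-- Membership in the double coset `B₋ w B₋`. -/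
def InBmWBm (w : Equiv.Perm (Fin n)) (g : Matrix (Fin n) (Fin n) K) : Prop :=
  ∃ b₁ b₂ : Matrix (Fin n) (Fin n) K, IsBm b₁ ∧ IsBm b₂ ∧ g = b₁ * pdot w * b₂

/-- `Δ^I_J(g)`: the minor with row set `I` and column set `J` (junk value 0 if sizes differ). -/
def minor (g : Matrix (Fin n) (Fin n) K) (I J : Finset (Fin n)) : K :=
  if h : I.card = J.card then
    Matrix.det (Matrix.of fun a b : Fin I.card =>
      g (I.orderEmbOfFin rfl a) (J.orderEmbOfFin h.symm b))
  else 0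

/-- All right-aligned flag minors of `g` are nonnegative. -/
def RightFlagNonneg (g : Matrix (Fin n) (Fin n) ℝ) : Prop :=
  ∀ I : Finset (Fin n),
    0 ≤ minor g I (univ.filter fun j : Fin n => n - I.card ≤ (j : ℕ))

/-- All top-aligned flag minors of `g` are nonnegative. -/
def TopFlagNonneg (g : Matrix (Fin n) (Fin n) ℝ) : Prop :=
  ∀ J : Finset (Fin n),
    0 ≤ minor g (univ.filter fun i : Fin n => (i : ℕ) < J.card) J

/-- `x_i(t)` (with 1-based `i`): `Id + t·E_{i,i+1}`. -/
def xmat (i : ℕ) (t : K) : Matrix (Fin n) (Fin n) K :=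
  Matrix.of fun a b : Fin n =>
    if a = b then 1 else if (a : ℕ) + 1 = i ∧ (b : ℕ) = i then t else 0

/-- `y_i(t)` (with 1-based `i`): `Id + t·E_{i+1,i}`. -/
def ymat (i : ℕ) (t : K) : Matrix (Fin n) (Fin n) K :=
  Matrix.of fun a b : Fin n =>
    if a = b then 1 else if (a : ℕ) = i ∧ (b : ℕ) + 1 = i then t else 0

/-- `ṡ_i` (with 1-based `i`). -/
def sdot (i : ℕ) : Matrix (Fin n) (Fin n) K :=
  Matrix.of fun a b : Fin n =>
    if (a : ℕ) + 1 = i ∧ (b : ℕ) = i then 1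
    else if (a : ℕ) = i ∧ (b : ℕ) + 1 = i then -1
    else if a = b ∧ (a : ℕ) + 1 ≠ i ∧ (a : ℕ) ≠ i then 1
    else 0

/-- The adjacent transposition `s_i` (with 1-based `i`); identity if out of range. -/
def sperm (n : ℕ) (i : ℕ) : Equiv.Perm (Fin n) :=
  if h : i < n then
    Equiv.swap ⟨i - 1, Nat.lt_of_le_of_lt (Nat.sub_le i 1) h⟩ ⟨i, h⟩
  else 1

/-- `ℓ(w)`: the number of inversions of `w`. -/
def len (w : Equiv.Perm (Fin n)) : ℕ :=
  (univ.filter fun p : Fin n × Fin n => p.1 < p.2 ∧ w p.2 < w p.1).card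

/-- `vseq ii v k = v_{(m-k)}`: the rightmost (positive distinguished) subexpression recursion. -/
def vseq (ii : Fin m → ℕ) (v : Equiv.Perm (Fin n)) : ℕ → Equiv.Perm (Fin n)
  | 0 => v
  | k + 1 =>
    if h : m - k - 1 < m then
      if len (vseq ii v k * sperm n (ii ⟨m - k - 1, h⟩)) < len (vseq ii v k) then
        vseq ii v k * sperm n (ii ⟨m - k - 1, h⟩)
      else vseq ii v k
    else vseq ii v k

/-- `r ∈ J°` (0-based `r`, corresponding to the 1-based index `r+1`). -/
def inJ (ii : Fin m → ℕ) (v : Equiv.Perm (Fin n)) (r : Fin m) : Prop :=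
  vseq ii v (m - (r : ℕ)) = vseq ii v (m - (r : ℕ) - 1)

/-- The list `[s_{i_1}, …, s_{i_m}]` of adjacent transpositions. -/
def sPermList (n : ℕ) (ii : Fin m → ℕ) : List (Equiv.Perm (Fin n)) :=
  List.ofFn fun r => sperm n (ii r)

/-- The list `[s^v_{i_1}, …, s^v_{i_m}]`. -/
def svPermList (ii : Fin m → ℕ) (v : Equiv.Perm (Fin n)) : List (Equiv.Perm (Fin n)) :=
  List.ofFn fun r => if inJ ii v r then 1 else sperm n (ii r)

/-- The factors `g_1, …, g_m` of the Marsh–Rietsch element. -/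
def mrgList (ii : Fin m → ℕ) (v : Equiv.Perm (Fin n)) (t : Fin m → K) :
    List (Matrix (Fin n) (Fin n) K) :=
  List.ofFn fun r => if inJ ii v r then xmat (ii r) (t r) else sdot (ii r)

/-- The Marsh–Rietsch element `g = g_1 ⋯ g_m`. -/
def mrg (ii : Fin m → ℕ) (v : Equiv.Perm (Fin n)) (t : Fin m → K) :
    Matrix (Fin n) (Fin n) K :=
  (mrgList ii v t).prod

/-- The list `[ṡ_{i_1}, …, ṡ_{i_m}]`. -/
def sdotList (n : ℕ) (ii : Fin m → ℕ) : List (Matrix (Fin n) (Fin n) K) :=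
  List.ofFn fun r => sdot (ii r)

/-- `ẇ = ṡ_{i_1} ⋯ ṡ_{i_m}`. -/
def wMR (n : ℕ) (ii : Fin m → ℕ) : Matrix (Fin n) (Fin n) K :=
  (sdotList n ii).prod

theorem minor_eq (g : Matrix (Fin n) (Fin n) K) (I J : Finset (Fin n)) {k : ℕ}
    (hI : I.card = k) (hJ : J.card = k) :
    minor g I J = (g.submatrix (I.orderEmbOfFin hI) (J.orderEmbOfFin hJ)).det := by
  subst hI
  unfold minor
  rw [dif_pos hJ.symm]
  rfl

theorem sum_emb (I : Finset (Fin n)) {k : ℕ} (hI : I.card = k) (f : Fin n → K)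
    (h : ∀ x, x ∉ I → f x = 0) : ∑ x, f x = ∑ a : Fin k, f (I.orderEmbOfFin hI a) := by
  rw [← Finset.sum_subset (Finset.subset_univ I) (fun x _ hx => h x hx)]
  have := Finset.sum_map univ (I.orderEmbOfFin hI).toEmbedding f
  refine Eq.trans ?_ this
  congr 1
  exact (Finset.map_orderEmbOfFin_univ I hI).symm

theorem minor_mul_rows (A M : Matrix (Fin n) (Fin n) K) (I L J : Finset (Fin n)) (k : ℕ)
    (hI : I.card = k) (hL : L.card = k) (hJ : J.card = k)
    (h : ∀ x ∈ I, ∀ y, y ∉ L → A x y = 0) :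
    minor (A * M) I J = minor A I L * minor M L J := by
  rw [minor_eq _ _ _ hI hJ, minor_eq _ _ _ hI hL, minor_eq _ _ _ hL hJ, ← Matrix.det_mul]
  congr 1
  ext a b
  simp only [Matrix.submatrix_apply, Matrix.mul_apply]
  apply sum_emb
  intro x hx
  rw [h _ (Finset.orderEmbOfFin_mem I hI a) x hx, zero_mul]

theorem minor_transpose (A : Matrix (Fin n) (Fin n) K) (I J : Finset (Fin n)) (k : ℕ)
    (hI : I.card = k) (hJ : J.card = k) : minor Aᵀ I J = minor A J I := by
  rw [minor_eq _ _ _ hI hJ, minor_eq _ _ _ hJ hI, ← Matrix.det_transpose]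
  rfl

theorem minor_mul_cols (A M : Matrix (Fin n) (Fin n) K) (I L J : Finset (Fin n)) (k : ℕ)
    (hI : I.card = k) (hL : L.card = k) (hJ : J.card = k)
    (h : ∀ x ∈ J, ∀ y, y ∉ L → M y x = 0) :
    minor (A * M) I J = minor A I L * minor M L J := by
  rw [← minor_transpose _ _ _ k hJ hI, Matrix.transpose_mul,
    minor_mul_rows Mᵀ Aᵀ _ L _ k hJ hL hI (fun x hx y hy => h x hx y hy),
    minor_transpose _ _ _ k hJ hL, minor_transpose _ _ _ k hL hI, mul_comm]

theorem minor_isN (A : Matrix (Fin n) (Fin n) K) (hA : IsN A) (J : Finset (Fin n)) :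
    minor A J J = 1 := by
  rw [minor_eq _ _ _ rfl rfl, Matrix.det_of_isUpperTriangular]
  · exact Finset.prod_eq_one (fun i _ => hA.1 _)
  · intro i j hij
    exact hA.2 _ _ ((J.orderEmbOfFin rfl).strictMono hij)

theorem isN_transpose {A : Matrix (Fin n) (Fin n) K} (hA : IsNm A) : IsN Aᵀ :=
  ⟨fun i => hA.1 i, fun i j h => hA.2 j i h⟩

theorem isNm_transpose {A : Matrix (Fin n) (Fin n) K} (hA : IsN A) : IsNm Aᵀ :=
  ⟨fun i => hA.1 i, fun i j h => hA.2 j i h⟩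

theorem minor_isNm (A : Matrix (Fin n) (Fin n) K) (hA : IsNm A) (J : Finset (Fin n)) :
    minor A J J = 1 := by
  rw [← minor_transpose A J J _ rfl rfl]
  exact minor_isN _ (isN_transpose hA) J

/-! adjacent indices -/

theorem xmat_eq (p q : Fin n) (i : ℕ) (hp : (p : ℕ) + 1 = i) (hq : (q : ℕ) = i) (t : K) :
    (xmat i t : Matrix (Fin n) (Fin n) K) = transvection p q t := by
  ext a b
  have hpq : p ≠ q := by intro h; subst h; omega
  have e1 : ((a : ℕ) + 1 = i) ↔ p = a := by rw [Fin.ext_iff]; omega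
  have e2 : ((b : ℕ) = i) ↔ q = b := by rw [Fin.ext_iff]; omega
  simp only [xmat, transvection, Matrix.of_apply, Matrix.add_apply, Matrix.one_apply,
    Matrix.single_apply, e1, e2]
  by_cases h : a = b
  · subst h
    by_cases h1 : p = a <;> by_cases h2 : q = a <;> simp_all
  · simp [h]

theorem sdot_eq (p q : Fin n) (i : ℕ) (hp : (p : ℕ) + 1 = i) (hq : (q : ℕ) = i) :
    (sdot i : Matrix (Fin n) (Fin n) K) =
      transvection p q 1 * transvection q p (-1) * transvection p q 1 := by
  have hpq : p ≠ q := by intro h; subst h; omega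
  have key : (transvection p q 1 * transvection q p (-1) * transvection p q 1 :
      Matrix (Fin n) (Fin n) K) = 1 + single p q 1 - single q p 1 - single p p 1 - single q q 1 := by
    have e1 : (single q p (-1) : Matrix (Fin n) (Fin n) K) = - single q p 1 := by
      rw [← Matrix.single_neg]
    simp only [transvection, e1, mul_add, add_mul, mul_neg, neg_mul, mul_one, one_mul,
      single_mul_single_same, single_mul_single_of_ne _ _ _ _ hpq,
      single_mul_single_of_ne _ _ _ _ hpq.symm]
    abel
  rw [key]
  ext a b
  have e1 : ∀ a : Fin n, ((a : ℕ) + 1 = i) ↔ p = a := by intro a; rw [Fin.ext_iff]; omega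
  have e2 : ∀ a : Fin n, ((a : ℕ) = i) ↔ q = a := by intro a; rw [Fin.ext_iff]; omega
  simp only [sdot, Matrix.of_apply, e1, e2, ne_eq, Matrix.add_apply, Matrix.sub_apply,
    Matrix.single_apply, Matrix.one_apply]
  by_cases h1 : p = a <;> by_cases h2 : q = a <;> by_cases h3 : p = b <;> by_cases h4 : q = b <;>
    by_cases h5 : a = b <;> simp_all

theorem det_sdot (p q : Fin n) (i : ℕ) (hp : (p : ℕ) + 1 = i) (hq : (q : ℕ) = i) :
    (sdot i : Matrix (Fin n) (Fin n) K).det = 1 := by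
  have hpq : p ≠ q := by intro h; subst h; omega
  rw [sdot_eq p q i hp hq]
  simp [det_transvection_of_ne, hpq, hpq.symm]

theorem sperm_eq (p q : Fin n) (i : ℕ) (hp : (p : ℕ) + 1 = i) (hq : (q : ℕ) = i) :
    sperm n i = Equiv.swap p q := by
  have : i < n := hq ▸ q.2
  unfold sperm
  rw [dif_pos this]
  congr 1
  · ext; simp; omega
  · ext; simp; omega

/-- entries of sdot through the swap -/
theorem sdot_apply (p q : Fin n) (i : ℕ) (hp : (p : ℕ) + 1 = i) (hq : (q : ℕ) = i) (a b : Fin n) :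
    (sdot i : Matrix (Fin n) (Fin n) K) a b =
      if a = Equiv.swap p q b then (if b = p then -1 else 1) else 0 := by
  have hpq : p ≠ q := by intro h; subst h; omega
  have e1 : ∀ a : Fin n, ((a : ℕ) + 1 = i) ↔ a = p := by intro a; rw [Fin.ext_iff]; omega
  have e2 : ∀ a : Fin n, ((a : ℕ) = i) ↔ a = q := by intro a; rw [Fin.ext_iff]; omega
  simp only [sdot, Matrix.of_apply, e1, e2, ne_eq, Equiv.swap_apply_def]
  split_ifs <;> simp_all

theorem mul_sdot_apply (p q : Fin n) (i : ℕ) (hp : (p : ℕ) + 1 = i) (hq : (q : ℕ) = i)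
    (A : Matrix (Fin n) (Fin n) K) (a b : Fin n) :
    (A * (sdot i : Matrix (Fin n) (Fin n) K)) a b = A a (Equiv.swap p q b) * (if b = p then -1 else 1) := by
  rw [Matrix.mul_apply, Finset.sum_eq_single (Equiv.swap p q b)]
  · rw [sdot_apply p q i hp hq, if_pos rfl]
  · intro c _ hc
    rw [sdot_apply p q i hp hq, if_neg hc, mul_zero]
  · simp

theorem sdotT_mul_apply (p q : Fin n) (i : ℕ) (hp : (p : ℕ) + 1 = i) (hq : (q : ℕ) = i)
    (A : Matrix (Fin n) (Fin n) K) (a b : Fin n) :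
    ((sdot i : Matrix (Fin n) (Fin n) K)ᵀ * A) a b = (if a = p then -1 else 1) * A (Equiv.swap p q a) b := by
  rw [← Matrix.transpose_apply A, mul_comm, ← mul_sdot_apply p q i hp hq]
  rw [← Matrix.transpose_apply (Aᵀ * _), Matrix.transpose_mul, Matrix.transpose_transpose]

theorem sdotT_mul (p q : Fin n) (i : ℕ) (hp : (p : ℕ) + 1 = i) (hq : (q : ℕ) = i) :
    (sdot i)ᵀ * (sdot i : Matrix (Fin n) (Fin n) K) = 1 := by
  ext a b
  rw [sdotT_mul_apply p q i hp hq, sdot_apply p q i hp hq, Matrix.one_apply]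
  simp only [EmbeddingLike.apply_eq_iff_eq]
  split_ifs <;> simp_all

theorem sdot_mulT (p q : Fin n) (i : ℕ) (hp : (p : ℕ) + 1 = i) (hq : (q : ℕ) = i) :
    (sdot i : Matrix (Fin n) (Fin n) K) * (sdot i)ᵀ = 1 :=
  mul_eq_one_comm.mp (sdotT_mul p q i hp hq)

theorem swap_lt (p q : Fin n) (hpq : (p : ℕ) + 1 = q) {a b : Fin n} (hab : a < b)
    (h : ¬ (a = p ∧ b = q)) : Equiv.swap p q a < Equiv.swap p q b := by
  simp only [Equiv.swap_apply_def, Fin.ext_iff, Fin.lt_def] at *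
  split_ifs <;> omega

/-! length -/

def lenE (p q : Fin n) (w : Equiv.Perm (Fin n)) : ℕ :=
  ((univ.filter fun x : Fin n × Fin n => x.1 < x.2 ∧ w x.2 < w x.1).erase (p, q)).card

theorem lenE_swap (p q : Fin n) (hpq : (p : ℕ) + 1 = q) (w : Equiv.Perm (Fin n)) :
    lenE p q (w * Equiv.swap p q) = lenE p q w := by
  unfold lenE
  apply Finset.card_bij' (fun x _ => (Equiv.swap p q x.1, Equiv.swap p q x.2))
    (fun x _ => (Equiv.swap p q x.1, Equiv.swap p q x.2))
  · rintro ⟨a, b⟩ hx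
    rw [mem_erase, mem_filter] at hx ⊢
    simp only [mem_univ, true_and, Equiv.Perm.mul_apply, ne_eq,
      Prod.mk.injEq] at hx ⊢
    refine ⟨?_, swap_lt p q hpq hx.2.1 hx.1, by simpa using hx.2.2⟩
    rintro ⟨h1, h2⟩
    have e1 : a = q := by rw [Equiv.swap_apply_eq_iff] at h1; simpa using h1
    have e2 : b = p := by rw [Equiv.swap_apply_eq_iff] at h2; simpa using h2
    have := hx.2.1
    rw [e1, e2, Fin.lt_def] at this
    omega
  · rintro ⟨a, b⟩ hx
    rw [mem_erase, mem_filter] at hx ⊢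
    simp only [mem_univ, true_and, Equiv.Perm.mul_apply, ne_eq,
      Prod.mk.injEq, Equiv.swap_apply_self] at hx ⊢
    refine ⟨?_, swap_lt p q hpq hx.2.1 hx.1, by simpa using hx.2.2⟩
    rintro ⟨h1, h2⟩
    have e1 : a = q := by rw [Equiv.swap_apply_eq_iff] at h1; simpa using h1
    have e2 : b = p := by rw [Equiv.swap_apply_eq_iff] at h2; simpa using h2
    have := hx.2.1
    rw [e1, e2, Fin.lt_def] at this
    omega
  · rintro ⟨a, b⟩ hx; simp
  · rintro ⟨a, b⟩ hx; simp

theorem len_eq (p q : Fin n) (hpq : (p : ℕ) + 1 = q) (w : Equiv.Perm (Fin n)) :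
    len w = lenE p q w + if w q < w p then 1 else 0 := by
  have hlt : p < q := by rw [Fin.lt_def]; omega
  unfold len lenE
  split_ifs with h
  · rw [Finset.card_erase_add_one]; simp [h, hlt]
  · rw [Finset.erase_eq_of_notMem]; rfl
    simp [h]

theorem len_swap (p q : Fin n) (hpq : (p : ℕ) + 1 = q) (w : Equiv.Perm (Fin n)) :
    (w p < w q ∧ len (w * Equiv.swap p q) = len w + 1) ∨
    (w q < w p ∧ len (w * Equiv.swap p q) + 1 = len w) := by
  have hne : w p ≠ w q := by
    intro h; have := w.injective h; rw [this] at hpq; omega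
  rw [len_eq p q hpq w, len_eq p q hpq (w * _), lenE_swap p q hpq]
  simp only [Equiv.Perm.mul_apply, Equiv.swap_apply_left, Equiv.swap_apply_right]
  rcases lt_or_gt_of_ne hne with h | h
  · left; simp [h, h.le]
  · right; simp [h, h.le]

/-! signed permutation matrices -/

def Pset (n i : ℕ) : Finset (Fin n) := univ.filter fun j : Fin n => (j : ℕ) < i

def Good (v : Equiv.Perm (Fin n)) (V : Matrix (Fin n) (Fin n) K) : Prop :=
  (∀ a b, a ≠ v b → V a b = 0) ∧ V * Vᵀ = 1 ∧
    ∀ i, minor V (Pset n i) ((Pset n i).image ⇑v⁻¹) = 1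

theorem card_im (v : Equiv.Perm (Fin n)) (P : Finset (Fin n)) : (P.image ⇑v⁻¹).card = P.card :=
  Finset.card_image_of_injective _ (v⁻¹).injective

theorem mem_im (v : Equiv.Perm (Fin n)) (P : Finset (Fin n)) (x : Fin n) :
    x ∈ P.image ⇑v⁻¹ ↔ v x ∈ P := by
  simp only [Finset.mem_image]
  constructor
  · rintro ⟨a, ha, rfl⟩; simpa using ha
  · intro h; exact ⟨v x, h, by simp⟩

theorem good_one : Good (1 : Equiv.Perm (Fin n)) (1 : Matrix (Fin n) (Fin n) K) := by
  refine ⟨fun a b h => Matrix.one_apply_ne h, by simp, fun i => ?_⟩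
  have : (Pset n i).image ⇑(1 : Equiv.Perm (Fin n))⁻¹ = Pset n i := by ext; simp
  rw [this]
  exact minor_isN _ ⟨fun i => by simp, fun i j h => Matrix.one_apply_ne h.ne'⟩ _

theorem minor_sdot (p q : Fin n) (i : ℕ) (hp : (p : ℕ) + 1 = i) (hq : (q : ℕ) = i)
    (J J' : Finset (Fin n)) (hJ : ∀ x, x ∈ J' ↔ Equiv.swap p q x ∈ J) (h : q ∈ J → p ∈ J) :
    minor (sdot i : Matrix (Fin n) (Fin n) K) J J' = 1 := by
  have hpq : p ≠ q := by intro h; subst h; omega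
  have hlt : p < q := by rw [Fin.lt_def]; omega
  have hJim : J' = J.image ⇑(Equiv.swap p q) := by
    ext x; rw [hJ, Finset.mem_image]
    constructor
    · intro h; exact ⟨_, h, by simp⟩
    · rintro ⟨a, h, rfl⟩; simpa using h
  have hc : J'.card = J.card := by
    rw [hJim, Finset.card_image_of_injective _ (Equiv.injective _)]
  by_cases hb : (p ∈ J ↔ q ∈ J)
  · have hJJ : J' = J := by
      ext x; rw [hJ, Equiv.swap_apply_def]
      split_ifs with h1 h2
      · rw [h1]; exact hb.symm
      · rw [h2]; exact hb
      · rfl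
    rw [hJJ, sdot_eq p q i hp hq]
    rw [minor_mul_rows _ _ J J J _ rfl rfl rfl, minor_mul_rows _ _ J J J _ rfl rfl rfl,
      minor_isN, minor_isNm]
    · simp
    · constructor
      · intro i; simp only [transvection, Matrix.add_apply, Matrix.single_apply, Matrix.one_apply]
        simp; intro h h'; exact absurd (h'.trans h.symm) hpq
      · intro i j hij
        simp only [transvection, Matrix.add_apply, Matrix.single_apply, Matrix.one_apply]
        simp [hij.ne]; intro h h'; subst h h'; exact absurd hij (not_lt.2 hlt.le)
    · constructor
      · intro i; simp only [transvection, Matrix.add_apply, Matrix.single_apply, Matrix.one_apply]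
        simp; intro h h'; exact absurd (h.trans h'.symm) hpq
      · intro i j hij
        simp only [transvection, Matrix.add_apply, Matrix.single_apply, Matrix.one_apply]
        simp [hij.ne']; intro h h'; subst h h'; exact absurd hij (not_lt.2 hlt.le)
    · intro x hx y hy
      simp only [transvection, Matrix.add_apply, Matrix.single_apply, Matrix.one_apply]
      have : x ≠ y := fun h => hy (h ▸ hx)
      simp [this]; rintro rfl rfl; exact absurd (hb.1 hx) hy
    · intro x hx y hy
      rw [Matrix.mul_apply]
      have hxy : x ≠ y := fun h => hy (h ▸ hx)
      apply Finset.sum_eq_zero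
      intro z _
      simp only [transvection, Matrix.add_apply, Matrix.single_apply, Matrix.one_apply]
      by_cases hz : z ∈ J
      · have : z ≠ y := fun h => hy (h ▸ hz)
        have : ¬ (q = z ∧ p = y) := by rintro ⟨rfl, rfl⟩; exact hy (hb.2 hz)
        simp [*]
      · have : x ≠ z := fun h => hz (h ▸ hx)
        have : ¬ (p = x ∧ q = z) := by rintro ⟨rfl, rfl⟩; exact hz (hb.1 hx)
        simp [*]
  · have hqJ : q ∉ J := fun hq => hb ⟨fun _ => hq, h⟩
    have he : (⇑(J'.orderEmbOfFin hc)) = fun a => Equiv.swap p q (J.orderEmbOfFin rfl a) := by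
      symm
      apply Finset.orderEmbOfFin_unique
      · intro x; rw [hJ]; simp
      · intro x y hxy
        apply swap_lt p q (by omega) ((J.orderEmbOfFin rfl).strictMono hxy)
        rintro ⟨_, h2⟩
        exact hqJ (h2 ▸ Finset.orderEmbOfFin_mem J rfl y)
    rw [minor_eq _ _ _ rfl hc, he]
    rw [← Matrix.det_one (n := Fin J.card)]
    congr 1
    ext a b
    rw [Matrix.submatrix_apply, sdot_apply p q i hp hq, Matrix.one_apply, Equiv.swap_apply_self]
    have : Equiv.swap p q (J.orderEmbOfFin rfl b) ≠ p := by
      intro h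
      rw [Equiv.swap_apply_eq_iff, Equiv.swap_apply_left] at h
      exact hqJ (h ▸ Finset.orderEmbOfFin_mem J rfl b)
    rw [if_neg this]
    simp

theorem good_step (p q : Fin n) (i : ℕ) (hp : (p : ℕ) + 1 = i) (hq : (q : ℕ) = i)
    (v : Equiv.Perm (Fin n)) (V : Matrix (Fin n) (Fin n) K) (hV : Good v V) (h : v p < v q) :
    Good (v * Equiv.swap p q) (V * sdot i) := by
  obtain ⟨h1, h2, h3⟩ := hV
  refine ⟨?_, ?_, ?_⟩
  · intro a b hab
    rw [mul_sdot_apply p q i hp hq, h1 _ _ (by simpa using hab), zero_mul]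
  · rw [Matrix.transpose_mul, Matrix.mul_assoc, ← Matrix.mul_assoc (sdot i) _ (Vᵀ), sdot_mulT p q i hp hq,
      Matrix.one_mul, h2]
  · intro k
    rw [minor_mul_cols V (sdot i) (Pset n k) ((Pset n k).image ⇑v⁻¹) _ (Pset n k).card rfl
      (card_im _ _) (card_im _ _), h3, one_mul]
    · apply minor_sdot p q i hp hq
      · intro x; rw [mem_im, mem_im]; rfl
      · rw [mem_im, mem_im]; simp only [Pset, mem_filter, mem_univ, true_and]
        intro h'; rw [Fin.lt_def] at h; omega
    · intro x hx y hy
      rw [sdot_apply p q i hp hq, if_neg]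
      rintro rfl
      rw [mem_im] at hx hy
      exact hy hx

theorem isBm_mul {A B : Matrix (Fin n) (Fin n) K} (hA : IsBm A) (hB : IsBm B) : IsBm (A * B) := by
  refine ⟨by rw [Matrix.det_mul, hA.1, hB.1, one_mul], fun i j hij => ?_⟩
  rw [Matrix.mul_apply]
  apply Finset.sum_eq_zero
  intro k _
  rcases lt_or_ge i k with h | h
  · rw [hA.2 _ _ h, zero_mul]
  · rw [hB.2 _ _ (lt_of_le_of_lt h hij), mul_zero]

theorem isN_mul {A B : Matrix (Fin n) (Fin n) K} (hA : IsN A) (hB : IsN B) : IsN (A * B) := by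
  refine ⟨fun i => ?_, fun i j hij => ?_⟩
  · rw [Matrix.mul_apply, Finset.sum_eq_single i, hA.1, hB.1, one_mul]
    · intro k _ hk
      rcases lt_or_gt_of_ne hk with h | h
      · rw [hA.2 _ _ h, zero_mul]
      · rw [hB.2 _ _ h, mul_zero]
    · simp
  · rw [Matrix.mul_apply]
    apply Finset.sum_eq_zero
    intro k _
    rcases lt_or_ge k i with h | h
    · rw [hA.2 _ _ h, zero_mul]
    · rw [hB.2 _ _ (lt_of_lt_of_le hij h), mul_zero]

theorem isBm_diag {X : Matrix (Fin n) (Fin n) K} (hX : IsBm X) : ∏ i, X i i = 1 := by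
  rw [← hX.1, ← Matrix.det_transpose, Matrix.det_of_isUpperTriangular]
  · rfl
  · intro i j hij; exact hX.2 _ _ hij

theorem isBm_diag_ne {X : Matrix (Fin n) (Fin n) K} (hX : IsBm X) (i : Fin n) : X i i ≠ 0 := by
  intro h
  have := isBm_diag hX
  rw [Finset.prod_eq_zero (f := fun i => X i i) (Finset.mem_univ i) h] at this
  exact zero_ne_one this

def CGood (w : Equiv.Perm (Fin n)) (C : Matrix (Fin n) (Fin n) K) : Prop :=
  (∀ a, C a a = 1) ∧ ∀ a b, a ≠ b → ¬ (a < b ∧ w b < w a) → C a b = 0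

theorem transv_apply (p q : Fin n) (t : K) (a b : Fin n) :
    transvection p q t a b = (if a = b then 1 else 0) + if p = a ∧ q = b then t else 0 := by
  simp only [transvection, Matrix.add_apply, Matrix.single_apply, Matrix.one_apply]

theorem isBm_transv (p q : Fin n) (h : p < q) (t : K) : IsBm (transvection q p t) := by
  refine ⟨det_transvection_of_ne _ _ h.ne' _, fun a b hab => ?_⟩
  rw [transv_apply, if_neg hab.ne, if_neg, add_zero]
  rintro ⟨rfl, rfl⟩
  exact absurd hab (not_lt.2 h.le)

theorem step_s (p q : Fin n) (i : ℕ) (hp : (p : ℕ) + 1 = i) (hq : (q : ℕ) = i)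
    (w : Equiv.Perm (Fin n)) (h : w p < w q) (C X : Matrix (Fin n) (Fin n) K)
    (hC : CGood w C) (hX : IsBm X) :
    ∃ C' X' : Matrix (Fin n) (Fin n) K, CGood (w * Equiv.swap p q) C' ∧ IsBm X' ∧
      C * X * sdot i = sdot i * C' * X' := by
  have hpq : p ≠ q := by intro h; subst h; omega
  have hlt : p < q := by rw [Fin.lt_def]; omega
  set S : Matrix (Fin n) (Fin n) K := sdot i with hS
  have hM : ∀ (A : Matrix (Fin n) (Fin n) K) a b, (Sᵀ * A * S) a b =
      (if a = p then -1 else 1) * A (Equiv.swap p q a) (Equiv.swap p q b) *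
        (if b = p then -1 else 1) := by
    intro A a b
    rw [hS, mul_sdot_apply p q i hp hq, sdotT_mul_apply p q i hp hq]
  set M := Sᵀ * X * S with hMdef
  set C1 := Sᵀ * C * S with hC1def
  have hqq : M q q ≠ 0 := by
    rw [hMdef, hM]; simpa [hpq.symm] using isBm_diag_ne hX p
  have hMlow : ∀ a b, a < b → ¬ (a = p ∧ b = q) → M a b = 0 := by
    intro a b hab hn
    rw [hMdef, hM, hX.2 _ _ (swap_lt p q (by omega) hab hn)]; simp
  set s := M p q / M q q with hs
  have hC1 : CGood (w * Equiv.swap p q) C1 := by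
    constructor
    · intro a; rw [hC1def, hM, hC.1]; split_ifs <;> simp
    · intro a b hab hn
      rw [hC1def, hM, hC.2]
      · simp
      · simpa using hab
      · rintro ⟨h1, h2⟩
        apply hn
        refine ⟨?_, h2⟩
        have := swap_lt p q (by omega) h1 ?_
        · simpa using this
        · rintro ⟨h3, h4⟩
          rw [h3, h4] at h2
          exact absurd h (not_lt.2 h2.le)
  refine ⟨C1 * transvection p q s, transvection p q (-s) * M, ⟨?_, ?_⟩, ⟨?_, ?_⟩, ?_⟩
  · intro a
    by_cases ha : a = q
    · subst ha
      rw [mul_transvection_apply_same, hC1.1, hC1.2 a p hpq.symm, mul_zero, add_zero]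
      rintro ⟨h1, _⟩; exact absurd hlt (not_lt.2 h1.le)
    · rw [mul_transvection_apply_of_ne _ _ _ _ ha, hC1.1]
  · intro a b hab hn
    by_cases hb : b = q
    · subst hb
      rw [mul_transvection_apply_same, hC1.2 a b hab hn, hC1.2 a p, mul_zero, add_zero]
      · rintro rfl
        apply hn
        simpa [hlt] using h
      · rintro ⟨h1, h2⟩
        apply hn
        refine ⟨h1.trans hlt, lt_trans ?_ h2⟩
        simpa using h
    · rw [mul_transvection_apply_of_ne _ _ _ _ hb, hC1.2 a b hab hn]
  · have := det_sdot (K := K) p q i hp hq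
    rw [Matrix.det_mul, det_transvection_of_ne _ _ hpq, hMdef, Matrix.det_mul, Matrix.det_mul,
      Matrix.det_transpose, hX.1, hS, this]
    simp
  · intro a b hab
    by_cases ha : a = p
    · subst ha
      rw [transvection_mul_apply_same]
      by_cases hb : b = q
      · subst hb
        rw [hs]; field_simp; ring
      · rw [hMlow a b hab (fun h => hb h.2), hMlow q b _ (fun h => hb h.2), mul_zero, add_zero]
        rw [Fin.lt_def] at *
        rw [Fin.ext_iff] at hb
        omega
    · rw [transvection_mul_apply_of_ne _ _ _ _ ha, hMlow a b hab (fun h => ha h.1)]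
  · have h1 : transvection p q s * transvection p q (-s) = (1 : Matrix (Fin n) (Fin n) K) := by
      rw [transvection_mul_transvection_same _ _ hpq]; simp
    have h2 : S * Sᵀ = 1 := sdot_mulT p q i hp hq
    calc C * X * S = (S * Sᵀ) * C * (S * Sᵀ) * X * S := by simp [h2]
      _ = S * C1 * M := by simp only [hC1def, hMdef, Matrix.mul_assoc]
      _ = S * C1 * (transvection p q s * transvection p q (-s)) * M := by simp [h1]
      _ = _ := by simp only [Matrix.mul_assoc]

theorem step_x (p q : Fin n) (i : ℕ) (hp : (p : ℕ) + 1 = i) (hq : (q : ℕ) = i)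
    (w : Equiv.Perm (Fin n)) (h : w p < w q) (C X : Matrix (Fin n) (Fin n) K)
    (hC : CGood w C) (hX : IsBm X) (t : K) (ht : t ≠ 0) :
    ∃ C' X' : Matrix (Fin n) (Fin n) K, CGood (w * Equiv.swap p q) C' ∧ IsBm X' ∧
      C * X * xmat i t = sdot i * C' * X' := by
  have hpq : p ≠ q := by intro h; subst h; omega
  have hlt : p < q := by rw [Fin.lt_def]; omega
  rw [xmat_eq p q i hp hq]
  obtain ⟨C', X', h1, h2, h3⟩ := step_s p q i hp hq w h C (X * transvection q p t⁻¹) hC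
    (isBm_mul hX (isBm_transv p q hlt _))
  set S : Matrix (Fin n) (Fin n) K := sdot i with hS
  have hSS : S * Sᵀ = 1 := sdot_mulT p q i hp hq
  set L := Sᵀ * (transvection q p (-t⁻¹) * transvection p q t) with hLdef
  have hL : IsBm L := by
    constructor
    · have := det_sdot (K := K) p q i hp hq
      rw [hLdef, Matrix.det_mul, Matrix.det_mul, Matrix.det_transpose, hS, this,
        det_transvection_of_ne _ _ hpq, det_transvection_of_ne _ _ hpq.symm]
      simp
    · intro a b hab
      rw [hLdef, hS, sdotT_mul_apply p q i hp hq]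
      by_cases ha : a = p
      · subst ha
        rw [Equiv.swap_apply_left, transvection_mul_apply_same]
        by_cases hb : b = q
        · subst hb
          simp [transv_apply, hpq, ht]
        · simp [transv_apply, hpq, hab.ne, Ne.symm hb]
      · by_cases ha' : a = q
        · subst ha'
          rw [Equiv.swap_apply_right, transvection_mul_apply_of_ne _ _ _ _ hpq]
          have : p ≠ b := (hlt.trans hab).ne
          simp [transv_apply, hab.ne, this]
        · rw [Equiv.swap_apply_of_ne_of_ne ha ha', transvection_mul_apply_of_ne _ _ _ _ ha']
          simp [transv_apply, hab.ne, Ne.symm ha]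
  refine ⟨C', X' * L, h1, isBm_mul h2 hL, ?_⟩
  have hy : transvection q p t⁻¹ * transvection q p (-t⁻¹) = (1 : Matrix (Fin n) (Fin n) K) := by
    rw [transvection_mul_transvection_same _ _ hpq.symm]; simp
  calc C * X * transvection p q t
      = C * X * (transvection q p t⁻¹ * transvection q p (-t⁻¹)) * transvection p q t := by
        rw [hy, Matrix.mul_one]
    _ = C * (X * transvection q p t⁻¹) * (S * Sᵀ) *
        (transvection q p (-t⁻¹) * transvection p q t) := by
        rw [hSS]; simp only [Matrix.mul_assoc, Matrix.mul_one, Matrix.one_mul]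
    _ = (C * (X * transvection q p t⁻¹) * S) * L := by
        rw [hLdef]; simp only [Matrix.mul_assoc]
    _ = _ := by rw [h3]; simp only [Matrix.mul_assoc]

theorem step_N (p q : Fin n) (v : Equiv.Perm (Fin n)) (h : v p < v q)
    (V : Matrix (Fin n) (Fin n) K) (hV : Good v V) (t : K) :
    ∃ U : Matrix (Fin n) (Fin n) K, IsN U ∧ V * transvection p q t = U * V := by
  have hVV : Vᵀ * V = 1 := mul_eq_one_comm.mp hV.2.1
  have he : V * transvection p q t * Vᵀ = 1 + V * single p q t * Vᵀ := by
    rw [transvection, mul_add, add_mul, mul_one, hV.2.1]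
  have hent : ∀ a b, (V * single p q t * Vᵀ) a b = V a p * t * V b q := by
    intro a b
    rw [Matrix.mul_apply, Finset.sum_eq_single q]
    · rw [mul_single_apply_same, Matrix.transpose_apply]
    · intro c _ hc
      rw [mul_single_apply_of_ne _ _ _ _ _ hc, zero_mul]
    · simp
  have hz : ∀ a b, b ≤ a → V a p * t * V b q = 0 := by
    intro a b hab
    by_cases h1 : a = v p
    · by_cases h2 : b = v q
      · subst h1 h2; exact absurd h (not_lt.2 hab)
      · rw [hV.1 b q h2, mul_zero]
    · rw [hV.1 a p h1]; simp
  refine ⟨V * transvection p q t * Vᵀ, ⟨?_, ?_⟩, ?_⟩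
  · intro a; rw [he, Matrix.add_apply, hent, hz a a le_rfl]; simp
  · intro a b hab; rw [he, Matrix.add_apply, hent, hz a b hab.le, Matrix.one_apply_ne hab.ne']; simp
  · rw [Matrix.mul_assoc, hVV, Matrix.mul_one]

def Inv (v w : Equiv.Perm (Fin n)) (g W : Matrix (Fin n) (Fin n) K) : Prop :=
  (∃ U V, IsN U ∧ Good v V ∧ g = U * V) ∧ Good w W ∧
    ∃ C X, CGood w C ∧ IsBm X ∧ g = W * C * X

theorem inv_one : Inv (1 : Equiv.Perm (Fin n)) 1 (1 : Matrix (Fin n) (Fin n) K) 1 := by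
  refine ⟨⟨1, 1, ⟨by simp, fun i j h => Matrix.one_apply_ne h.ne'⟩, good_one, by simp⟩, good_one,
    1, 1, ⟨by simp, fun i j h _ => Matrix.one_apply_ne h⟩,
    ⟨by simp, fun i j h => Matrix.one_apply_ne h.ne⟩, by simp⟩

theorem inv_s (p q : Fin n) (i : ℕ) (hp : (p : ℕ) + 1 = i) (hq : (q : ℕ) = i)
    (v w : Equiv.Perm (Fin n)) (g W : Matrix (Fin n) (Fin n) K) (h : Inv v w g W)
    (hv : v p < v q) (hw : w p < w q) :
    Inv (v * Equiv.swap p q) (w * Equiv.swap p q) (g * sdot i) (W * sdot i) := by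
  obtain ⟨⟨U, V, hU, hV, hg⟩, hW, C, X, hC, hX, hg'⟩ := h
  refine ⟨⟨U, V * sdot i, hU, good_step p q i hp hq v V hV hv, by rw [hg, Matrix.mul_assoc]⟩,
    good_step p q i hp hq w W hW hw, ?_⟩
  obtain ⟨C', X', h1, h2, h3⟩ := step_s p q i hp hq w hw C X hC hX
  refine ⟨C', X', h1, h2, ?_⟩
  rw [hg', Matrix.mul_assoc W, Matrix.mul_assoc W, h3]; simp only [Matrix.mul_assoc]

theorem inv_x (p q : Fin n) (i : ℕ) (hp : (p : ℕ) + 1 = i) (hq : (q : ℕ) = i)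
    (v w : Equiv.Perm (Fin n)) (g W : Matrix (Fin n) (Fin n) K) (h : Inv v w g W)
    (hv : v p < v q) (hw : w p < w q) (t : K) (ht : t ≠ 0) :
    Inv v (w * Equiv.swap p q) (g * xmat i t) (W * sdot i) := by
  obtain ⟨⟨U, V, hU, hV, hg⟩, hW, C, X, hC, hX, hg'⟩ := h
  obtain ⟨U', hU', hUV⟩ := step_N p q v hv V hV t
  refine ⟨⟨U * U', V, isN_mul hU hU', hV, ?_⟩,
    good_step p q i hp hq w W hW hw, ?_⟩
  · rw [hg, xmat_eq p q i hp hq, Matrix.mul_assoc, hUV, Matrix.mul_assoc]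
  obtain ⟨C', X', h1, h2, h3⟩ := step_x p q i hp hq w hw C X hC hX t ht
  refine ⟨C', X', h1, h2, ?_⟩
  rw [hg', Matrix.mul_assoc W, Matrix.mul_assoc W, h3]; simp only [Matrix.mul_assoc]

/-! conclusion from the invariant -/

theorem diag_of_upper_lower (A D c C : Matrix (Fin n) (Fin n) K) (hA : IsUnit A.det)
    (hAu : ∀ i j : Fin n, j < i → A i j = 0) (hDu : ∀ i j : Fin n, j < i → D i j = 0)
    (hc : IsNm c) (hC : IsNm C) (h : D * c = A * C) : c = C := by
  have hct : cᵀ.det = 1 := by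
    rw [Matrix.det_of_isUpperTriangular]
    · exact Finset.prod_eq_one (fun i _ => hc.1 i)
    · intro i j hij; exact hc.2 _ _ hij
  have hcu : IsUnit c.det := by rw [← Matrix.det_transpose, hct]; exact isUnit_one
  set T := A⁻¹ * D with hT
  have hTc : T * c = C := by
    rw [hT, Matrix.mul_assoc, h, ← Matrix.mul_assoc, Matrix.nonsing_inv_mul _ hA, Matrix.one_mul]
  have hTc' : T = C * c⁻¹ := by
    rw [← hTc, Matrix.mul_assoc, Matrix.mul_nonsing_inv _ hcu, Matrix.mul_one]
  haveI : Invertible A := Matrix.invertibleOfIsUnitDet A hA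
  haveI : Invertible c := Matrix.invertibleOfIsUnitDet c hcu
  have hAb : A.BlockTriangular id := fun i j hij => hAu i j hij
  have hDb : D.BlockTriangular id := fun i j hij => hDu i j hij
  have hcb : c.BlockTriangular OrderDual.toDual := fun i j hij => hc.2 i j hij
  have hCb : C.BlockTriangular OrderDual.toDual := fun i j hij => hC.2 i j hij
  have hTu : T.BlockTriangular id :=
    (Matrix.blockTriangular_inv_of_blockTriangular hAb).mul hDb
  have hTl : T.BlockTriangular OrderDual.toDual := by
    rw [hTc']; exact hCb.mul (Matrix.blockTriangular_inv_of_blockTriangular hcb)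
  have hTd : T = Matrix.diagonal fun i => T i i := by
    ext i j
    by_cases hij : i = j
    · subst hij; simp
    · rw [Matrix.diagonal_apply_ne _ hij]
      rcases lt_or_gt_of_ne hij with h | h
      · exact hTl h
      · exact hTu h
  have : ∀ i, T i i = 1 := by
    intro i
    have := congrFun (congrFun hTc i) i
    rw [hTd, Matrix.diagonal_mul, hc.1, hC.1, mul_one] at this
    exact this
  have hT1 : T = 1 := by
    rw [hTd]; simp [this]
  rw [← hTc, hT1, Matrix.one_mul]

theorem final (v w : Equiv.Perm (Fin n)) (g W : Matrix (Fin n) (Fin n) K) (h : Inv v w g W) :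
    (∃ a b c, UDL (gᵀ * W) a b c) ∧
    ∀ a b c, UDL (gᵀ * W) a b c → ∀ i : ℕ,
      minor a ((Pset n i).image ⇑v⁻¹) ((Pset n i).image ⇑w⁻¹) *
        minor g (Pset n i) ((Pset n i).image ⇑w⁻¹) = 1 := by
  obtain ⟨⟨U, V, hU, hV, hg⟩, hW, C, X, hC, hX, hg'⟩ := h
  have hWW : Wᵀ * W = 1 := mul_eq_one_comm.mp hW.2.1
  have hM : gᵀ * W = Xᵀ * Cᵀ := by
    rw [hg', Matrix.transpose_mul, Matrix.transpose_mul, Matrix.mul_assoc, Matrix.mul_assoc, hWW,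
      Matrix.mul_one]
  have hCN : IsN C := ⟨hC.1, fun i j hij => hC.2 i j hij.ne' (fun h => absurd hij (not_lt.2 h.1.le))⟩
  have hCNm := isNm_transpose hCN
  constructor
  · have hne := isBm_diag_ne hX
    refine ⟨Xᵀ * Matrix.diagonal fun i => (X i i)⁻¹, Matrix.diagonal fun i => X i i, Cᵀ,
      ⟨?_, ?_⟩, ⟨?_, ?_⟩, hCNm, ?_⟩
    · intro i; rw [Matrix.mul_diagonal, Matrix.transpose_apply, mul_inv_cancel₀ (hne i)]
    · intro i j hij; rw [Matrix.mul_diagonal, Matrix.transpose_apply, hX.2 _ _ hij, zero_mul]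
    · rw [Matrix.det_diagonal, isBm_diag hX]
    · intro i j hij; exact Matrix.diagonal_apply_ne _ hij
    · rw [hM, Matrix.mul_assoc Xᵀ, Matrix.diagonal_mul_diagonal]
      simp [hne]
  · rintro a b c ⟨ha, hb, hc, habc⟩ i
    have hcC : c = Cᵀ := by
      apply diag_of_upper_lower Xᵀ (a * b) c Cᵀ _ _ _ hc hCNm
      · rw [← habc, hM]
      · rw [Matrix.det_transpose, hX.1]; exact isUnit_one
      · intro i j hij; exact hX.2 _ _ hij
      · intro i j hij
        rw [Matrix.mul_apply]
        apply Finset.sum_eq_zero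
        intro k _
        by_cases hk : k = j
        · subst hk; rw [ha.2 _ _ hij, zero_mul]
        · rw [hb.2 _ _ hk, mul_zero]
    set P := Pset n i with hP
    set I := P.image ⇑v⁻¹ with hI
    set J := P.image ⇑w⁻¹ with hJ
    have cI : I.card = P.card := card_im _ _
    have cJ : J.card = P.card := card_im _ _
    have hlow : ∀ x y : Fin n, x ∈ P → y ∉ P → x < y := by
      intro x y hx hy
      simp only [hP, Pset, mem_filter, mem_univ, true_and] at hx hy
      rw [Fin.lt_def]; omega
    have hCs : ∀ x ∈ J, ∀ y, y ∉ J → C x y = 0 := by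
      intro x hx y hy
      apply hC.2
      · rintro rfl; exact hy hx
      · rintro ⟨_, h2⟩
        rw [hJ, mem_im] at hx hy
        exact absurd (hlow _ _ hx hy) (not_lt.2 h2.le)
    have hbs : ∀ x ∈ J, ∀ y, y ∉ J → b x y = 0 := by
      intro x hx y hy
      apply hb.2; rintro rfl; exact hy hx
    have hbt : bᵀ = b := by
      ext x y
      by_cases hxy : x = y
      · subst hxy; rfl
      · rw [Matrix.transpose_apply, hb.2 _ _ hxy, hb.2 _ _ (Ne.symm hxy)]
    have hWs : ∀ x ∈ P, ∀ y, y ∉ J → W x y = 0 := by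
      intro x hx y hy
      apply hW.1; rintro rfl; rw [hJ, mem_im] at hy; exact hy hx
    have e1 : minor (gᵀ * W) I J = 1 := by
      rw [hg, Matrix.transpose_mul, Matrix.mul_assoc,
        minor_mul_rows _ _ I P J P.card cI rfl cJ, minor_mul_rows _ _ P P J P.card rfl rfl cJ,
        minor_transpose _ _ _ P.card cI rfl, hV.2.2, hW.2.2, minor_isNm _ (isNm_transpose hU)]
      · simp
      · intro x hx y hy; exact hU.2 _ _ (hlow x y hx hy)
      · intro x hx y hy
        apply hV.1; rintro rfl; rw [hI, mem_im] at hx; exact hy hx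
    have e2 : minor (gᵀ * W) I J = minor a I J * minor b J J := by
      rw [habc, minor_mul_cols _ _ I J J P.card cI cJ cJ, minor_mul_cols _ _ I J J P.card cI cJ cJ,
        minor_isNm _ hc, mul_one]
      · intro x hx y hy; rw [← hbt]; exact hbs x hx y hy
      · intro x hx y hy; rw [hcC]; exact hCs x hx y hy
    have e3 : minor g P J = minor b J J := by
      have : g = W * (cᵀ * (b * aᵀ)) := by
        have h1 : Wᵀ * g = cᵀ * (b * aᵀ) := by
          have := congrArg Matrix.transpose habc
          rw [Matrix.transpose_mul, Matrix.transpose_transpose, Matrix.transpose_mul,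
            Matrix.transpose_mul, hbt] at this
          exact this
        rw [← h1, ← Matrix.mul_assoc, hW.2.1, Matrix.one_mul]
      rw [this, minor_mul_rows _ _ P J J P.card rfl cJ cJ hWs,
        minor_mul_rows _ _ J J J P.card cJ cJ cJ, minor_mul_rows _ _ J J J P.card cJ cJ cJ hbs,
        hW.2.2, minor_isN _ (isN_transpose hc), minor_isNm _ (isNm_transpose ha)]
      · simp
      · intro x hx y hy; rw [hcC]; exact hCs x hx y hy
    rw [e3, ← e2, e1]

/-! the word -/

theorem len_prefix (ii : Fin m → ℕ) (hii : ∀ r, 1 ≤ ii r ∧ ii r < n)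
    (hred : len (sPermList n ii).prod = m) (r : ℕ) (hr : r ≤ m) :
    len ((sPermList n ii).take r).prod = r := by
  have hL : (sPermList n ii).length = m := by simp [sPermList]
  have step : ∀ k, k < m → len ((sPermList n ii).take (k+1)).prod ≤
      len ((sPermList n ii).take k).prod + 1 := by
    intro k hk
    rw [List.prod_take_succ _ _ (by omega)]
    have e : (sPermList n ii)[k]'(by omega) = sperm n (ii ⟨k, hk⟩) := by simp [sPermList]
    have hi := hii ⟨k, hk⟩
    rw [e, sperm_eq ⟨ii ⟨k, hk⟩ - 1, by omega⟩ ⟨ii ⟨k, hk⟩, hi.2⟩ _ (by simp; omega) rfl]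
    rcases len_swap (n := n) ⟨ii ⟨k, hk⟩ - 1, by omega⟩ ⟨ii ⟨k, hk⟩, hi.2⟩ (by simp; omega)
      ((sPermList n ii).take k).prod with h | h
    · exact h.2.le
    · have := h.2; omega
  have up : ∀ k, k ≤ m → len ((sPermList n ii).take k).prod ≤ k := by
    intro k
    induction k with
    | zero =>
      intro _
      simp [len]
      apply Finset.filter_false_of_mem
      rintro x _ ⟨h1, h2⟩
      exact absurd h1 (not_lt.2 h2.le)
    | succ k ih =>
      intro hk
      have := step k (by omega); have := ih (by omega); omega
  have down : ∀ d, d ≤ m → m ≤ len ((sPermList n ii).take (m - d)).prod + d := by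
    intro d
    induction d with
    | zero =>
      intro _
      rw [Nat.sub_zero, List.take_of_length_le (by omega), hred]; simp
    | succ d ih =>
      intro hd
      have h1 := step (m - (d + 1)) (by omega)
      have h2 := ih (by omega)
      rw [show m - (d+1) + 1 = m - d by omega] at h1
      omega
  have h1 := up r hr
  have h2 := down (m - r) (by omega)
  rw [show m - (m - r) = r by omega] at h2
  omega

theorem inv_prefix (ii : Fin m → ℕ) (hii : ∀ r, 1 ≤ ii r ∧ ii r < n)
    (hred : len (sPermList n ii).prod = m)
    (v : Equiv.Perm (Fin n)) (hv0 : vseq ii v m = 1)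
    (t : Fin m → K) (ht : ∀ r, inJ ii v r → t r ≠ 0) (r : ℕ) (hr : r ≤ m) :
    Inv (vseq ii v (m - r)) ((sPermList n ii).take r).prod ((mrgList ii v t).take r).prod
      ((sdotList n ii).take r).prod := by
  induction r with
  | zero => simpa [hv0] using inv_one
  | succ r ih =>
    have hrm : r < m := hr
    specialize ih hrm.le
    obtain ⟨hi1, hi2⟩ := hii ⟨r, hrm⟩
    have len1 := len_prefix ii hii hred r hrm.le
    have len2 := len_prefix ii hii hred (r+1) hr
    rw [List.prod_take_succ _ _ (by simp [sPermList]; omega)] at len2 ⊢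
    rw [List.prod_take_succ _ _ (by simp [mrgList]; omega),
      List.prod_take_succ _ _ (by simp [sdotList]; omega)]
    have e1 : (sPermList n ii)[r]'(by simp [sPermList]; omega) = sperm n (ii ⟨r, hrm⟩) := by
      simp [sPermList]
    have e2 : (sdotList n ii : List (Matrix (Fin n) (Fin n) K))[r]'(by simp [sdotList]; omega) =
        sdot (ii ⟨r, hrm⟩) := by
      simp [sdotList]
    have e3 : (mrgList ii v t)[r]'(by simp [mrgList]; omega) =
        if inJ ii v ⟨r, hrm⟩ then xmat (ii ⟨r, hrm⟩) (t ⟨r, hrm⟩) else sdot (ii ⟨r, hrm⟩) := by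
      simp [mrgList]
    rw [e1] at len2
    rw [e1, e2, e3]
    obtain ⟨p, q, hp, hq⟩ : ∃ p q : Fin n, (p : ℕ) + 1 = ii ⟨r, hrm⟩ ∧ (q : ℕ) = ii ⟨r, hrm⟩ :=
      ⟨⟨ii ⟨r, hrm⟩ - 1, by omega⟩, ⟨ii ⟨r, hrm⟩, hi2⟩, by simp; omega, rfl⟩
    have hpq : (p : ℕ) + 1 = q := by omega
    have hsp := sperm_eq p q _ hp hq
    rw [hsp] at len2 ⊢
    set w := ((sPermList n ii).take r).prod
    have hw : w p < w q := by
      rcases len_swap p q hpq w with h | h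
      · exact h.1
      · have := h.2; omega
    obtain ⟨k, hk⟩ : ∃ k, k = m - (r + 1) := ⟨_, rfl⟩
    have hvs : vseq ii v (k + 1) = if len (vseq ii v k * Equiv.swap p q) < len (vseq ii v k) then
        vseq ii v k * Equiv.swap p q else vseq ii v k := by
      have hkr : m - k - 1 = r := by omega
      have : ∀ (x : ℕ) (hx : x < m), x = r → sperm n (ii ⟨x, hx⟩) = Equiv.swap p q := by
        rintro x hx rfl; exact hsp
      rw [vseq, dif_pos (by omega), this _ _ hkr]
    have hJ : inJ ii v ⟨r, hrm⟩ ↔ vseq ii v (k + 1) = vseq ii v k := by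
      unfold inJ
      rw [show m - ((⟨r, hrm⟩ : Fin m) : ℕ) = k + 1 by simp; omega]; rfl
    rw [show m - r = k + 1 by omega] at ih
    rw [← hk]
    set u := vseq ii v k
    by_cases hin : inJ ii v ⟨r, hrm⟩
    · rw [if_pos hin]
      have hu := hJ.1 hin
      rw [hu] at ih hvs
      apply inv_x p q _ hp hq _ _ _ _ ih _ hw _ (ht _ hin)
      rcases len_swap p q hpq u with h | h
      · exact h.1
      · rw [if_pos (by omega)] at hvs
        have := h.2
        rw [← hvs] at this; omega
    · rw [if_neg hin]
      have hlt : len (u * Equiv.swap p q) < len u := by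
        by_contra hc
        rw [if_neg hc] at hvs
        exact hin (hJ.2 hvs)
      rw [if_pos hlt] at hvs
      have hu : u = vseq ii v (k+1) * Equiv.swap p q := by
        rw [hvs, mul_assoc, Equiv.swap_mul_self, mul_one]
      rw [hu]
      apply inv_s p q _ hp hq _ _ _ _ ih _ hw
      rw [hvs]
      rcases len_swap p q hpq u with h | h
      · omega
      · simpa using h.1

/-- `Δ^{v⁻¹[i]}_{w⁻¹[i]}(y⃗) · Δ^{[i]}_{w⁻¹[i]}(g) = 1` (Lemma 7.8, type A). -/
theorem statement_14 {n m : ℕ} (hn : 1 ≤ n) (ii : Fin m → ℕ)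
    (hii : ∀ r, 1 ≤ ii r ∧ ii r < n)
    (w : Equiv.Perm (Fin n)) (hw : w = (sPermList n ii).prod) (hred : len w = m)
    (v : Equiv.Perm (Fin n)) (hv0 : vseq ii v m = 1)
    (t : Fin m → ℂ) (ht : ∀ r, inJ ii v r → t r ≠ 0) :
    (∃ a b c, UDL ((mrg ii v t)ᵀ * wMR n ii) a b c) ∧
    ∀ a b c, UDL ((mrg ii v t)ᵀ * wMR n ii) a b c →
      ∀ i : ℕ, 1 ≤ i → i ≤ n →
        minor a
            ((univ.filter fun j : Fin n => (j : ℕ) < i).image ⇑v⁻¹)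
            ((univ.filter fun j : Fin n => (j : ℕ) < i).image ⇑w⁻¹)
          *
          minor (mrg ii v t)
            (univ.filter fun j : Fin n => (j : ℕ) < i)
            ((univ.filter fun j : Fin n => (j : ℕ) < i).image ⇑w⁻¹)
        = 1 := by
  have h := inv_prefix ii hii (hw ▸ hred) v hv0 t ht m le_rfl
  rw [List.take_of_length_le (by simp [sPermList]), List.take_of_length_le (by simp [mrgList]),
    List.take_of_length_le (by simp [sdotList]), Nat.sub_self, ← hw] at h
  obtain ⟨h1, h2⟩ := final v w (mrg ii v t) (wMR n ii) h
  exact ⟨h1, fun a b c habc i _ _ => h2 a b c habc i⟩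

end
end Paper
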